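/- arXiv:1404.2443 — 3 statements merged into one kernel-verified Lean document; each statement's English description precedes it below -/
import Mathlib

section
/- Every n-gon with n ≥ 7 is a section of a 3-polytope with at most n − 1 vertices: if p_0, …, p_{n−1} ∈ ℝ² (n ≥ 7) are in clockwise convex position and P = conv{p_0, …, p_{n−1}}, then there exist a finite set V ⊆ ℝ³ with |V| ≤ n − 1 and an injective affine map f : ℝ² → ℝ³ such that conv(V) ∩ range(f) = f(P). -/
open Matrix

/-- Homogeneous coordinates of a point in the plane. -/
noncomputable def hat (p : Fin 2 → ℝ) : Fin 3 → ℝ := ![p 0, p 1, 1]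

/-- Determinant of the 3×3 matrix with rows `u`, `v`, `w`. -/
def det3 (u v w : Fin 3 → ℝ) : ℝ := Matrix.det (Matrix.of ![u, v, w])

/-- The negated bracket of three vectors: positive for points in clockwise position. -/
noncomputable def area (u v w : Fin 3 → ℝ) : ℝ := -det3 u v w

lemma area_eq (u v w : Fin 3 → ℝ) : area u v w =
    -(u 0 * v 1 * w 2 - u 0 * v 2 * w 1 - u 1 * v 0 * w 2 + u 1 * v 2 * w 0
      + u 2 * v 0 * w 1 - u 2 * v 1 * w 0) := by
  simp [area, det3, Matrix.det_fin_three]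

lemma area_rotate (u v w : Fin 3 → ℝ) : area v w u = area u v w := by
  simp only [area_eq]; ring

/-- Four vectors in three-space satisfy Cramer's linear relation. -/
lemma area_cramer (a b c d : Fin 3 → ℝ) (i : Fin 3) :
    area b c d * a i + area a b d * c i = area a c d * b i + area a b c * d i := by
  fin_cases i <;> simp only [area_eq] <;> simp <;> ring

/-- All ordered triples of the seven vectors are clockwise. -/
def IsClockwise (x : Fin 7 → Fin 3 → ℝ) : Prop :=
  ∀ i j k : Fin 7, i < j → j < k → 0 < area (x i) (x j) (x k)

/-- The cyclic relabelling of seven vectors that starts at index `r`. -/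
def shift (x : Fin 7 → Fin 3 → ℝ) (r : Fin 7) : Fin 7 → Fin 3 → ℝ := fun i => x (i + r)

lemma shift_shift (x : Fin 7 → Fin 3 → ℝ) (r s : Fin 7) :
    shift (shift x r) s = shift x (s + r) := by
  funext i
  simp [shift, add_assoc]

namespace IsClockwise

variable {x : Fin 7 → Fin 3 → ℝ}

lemma shift_one (h : IsClockwise x) : IsClockwise (shift x 1) := by
  intro i j k hij hjk
  simp only [shift]
  by_cases hk : k = 6
  · subst hk
    have h0 : (6 : Fin 7) + 1 = 0 := rfl
    rw [h0, area_rotate]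
    apply h <;> grind
  · apply h <;> grind

lemma shift (h : IsClockwise x) (r : Fin 7) : IsClockwise (shift x r) := by
  induction r using Fin.induction with
  | zero =>
    have h0 : _root_.shift x 0 = x := by
      funext i
      simp [_root_.shift]
    rwa [h0]
  | succ r ih =>
    have := ih.shift_one
    rw [shift_shift] at this
    convert this using 2
    rw [add_comm, Fin.coeSucc_eq_succ]

end IsClockwise

/-- The intersection of the lines `12` and `56` lies beyond the line `04`. -/
def FailsRight (x : Fin 7 → Fin 3 → ℝ) : Prop :=
  area (x 1) (x 2) (x 4) * area (x 0) (x 5) (x 6) <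
    area (x 0) (x 1) (x 2) * area (x 4) (x 5) (x 6)

/-- The intersection of the lines `12` and `56` lies beyond the line `03`. -/
def FailsLeft (x : Fin 7 → Fin 3 → ℝ) : Prop :=
  area (x 3) (x 5) (x 6) * area (x 0) (x 1) (x 2) <
    area (x 0) (x 5) (x 6) * area (x 1) (x 2) (x 3)

namespace IsClockwise

variable {x : Fin 7 → Fin 3 → ℝ}

lemma not_failsLeft_shift_four (h : IsClockwise x) (hR : FailsRight x) :
    ¬ FailsLeft (_root_.shift x 4) := by
  intro hL
  have hL : area (x 0) (x 2) (x 3) * area (x 4) (x 5) (x 6) <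
    area (x 4) (x 2) (x 3) * area (x 5) (x 6) (x 0) := hL
  rw [← area_rotate (x 4) (x 2) (x 3), area_rotate (x 0) (x 5) (x 6)] at hL
  have hP : area (x 0) (x 2) (x 3) * area (x 1) (x 2) (x 4) =
      area (x 2) (x 3) (x 4) * area (x 0) (x 1) (x 2) +
        area (x 0) (x 2) (x 4) * area (x 1) (x 2) (x 3) := by
    simp only [area_eq]; ring
  have p124 := h 1 2 4 (by decide) (by decide)
  have p056 := h 0 5 6 (by decide) (by decide)
  have p456 := h 4 5 6 (by decide) (by decide)
  have p023 := h 0 2 3 (by decide) (by decide)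
  have p024 := h 0 2 4 (by decide) (by decide)
  have p123 := h 1 2 3 (by decide) (by decide)
  have hlt := mul_lt_mul'' hR hL (by positivity) (by positivity)
  have hpos : 0 < area (x 0) (x 5) (x 6) * area (x 4) (x 5) (x 6) *
    (area (x 0) (x 2) (x 4) * area (x 1) (x 2) (x 3)) := by positivity
  refine lt_irrefl (0 : ℝ) ?_
  linear_combination hlt + hpos - area (x 0) (x 5) (x 6) * area (x 4) (x 5) (x 6) * hP

/-- Three products whose common factors cancel. -/
lemma _root_.mul_mul_lt_of_cyclic {a b c d e f g h i : ℝ} (ha : 0 < a) (hb : 0 < b) (hc : 0 < c)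
    (he : 0 < e) (hf : 0 < f) (hh : 0 < h) (h₁ : a * b < c * d) (h₂ : e * f < g * b)
    (h₃ : h * c < i * f) : a * e * h < d * g * i := by
  have h₄ := mul_lt_mul'' (mul_lt_mul'' h₁ h₂ (by positivity) (by positivity)) h₃
    (by positivity) (by positivity)
  refine lt_of_mul_lt_mul_right (a := b * c * f) ?_ (by positivity)
  linear_combination h₄

lemma not_failsRight_three (h : IsClockwise x) (h0 : FailsRight x)
    (h1 : FailsRight (_root_.shift x 1)) : ¬ FailsRight (_root_.shift x 2) := by
  intro h2
  have h1 : area (x 2) (x 3) (x 5) * area (x 1) (x 6) (x 0) <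
    area (x 1) (x 2) (x 3) * area (x 5) (x 6) (x 0) := h1
  have h2 : area (x 3) (x 4) (x 6) * area (x 2) (x 0) (x 1) <
    area (x 2) (x 3) (x 4) * area (x 6) (x 0) (x 1) := h2
  rw [area_rotate (x 0) (x 1) (x 6), area_rotate (x 0) (x 5) (x 6)] at h1
  rw [← area_rotate (x 2) (x 0) (x 1), ← area_rotate (x 6) (x 0) (x 1)] at h2
  have p012 := h 0 1 2 (by decide) (by decide)
  have p016 := h 0 1 6 (by decide) (by decide)
  have p056 := h 0 5 6 (by decide) (by decide)
  have p123 := h 1 2 3 (by decide) (by decide)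
  have p124 := h 1 2 4 (by decide) (by decide)
  have p125 := h 1 2 5 (by decide) (by decide)
  have p234 := h 2 3 4 (by decide) (by decide)
  have p235 := h 2 3 5 (by decide) (by decide)
  have p246 := h 2 4 6 (by decide) (by decide)
  have p345 := h 3 4 5 (by decide) (by decide)
  have p346 := h 3 4 6 (by decide) (by decide)
  have hlt := mul_mul_lt_of_cyclic p124 p056 p012 p235 p016 p346 h0 h1 h2
  have hP : area (x 1) (x 2) (x 4) * area (x 2) (x 3) (x 5) =
      area (x 1) (x 2) (x 3) * area (x 2) (x 4) (x 5) +
        area (x 1) (x 2) (x 5) * area (x 2) (x 3) (x 4) := by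
    simp only [area_eq]; ring
  have hQ : area (x 2) (x 4) (x 5) * area (x 3) (x 4) (x 6) =
      area (x 4) (x 5) (x 6) * area (x 2) (x 3) (x 4) +
        area (x 2) (x 4) (x 6) * area (x 3) (x 4) (x 5) := by
    simp only [area_eq]; ring
  have hpos : 0 < area (x 1) (x 2) (x 5) * area (x 2) (x 3) (x 4) * area (x 3) (x 4) (x 6) +
    area (x 1) (x 2) (x 3) * (area (x 2) (x 4) (x 6) * area (x 3) (x 4) (x 5)) := by positivity
  refine lt_irrefl (0 : ℝ) ?_
  linear_combination hlt + hpos - area (x 3) (x 4) (x 6) * hP - area (x 1) (x 2) (x 3) * hQ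

lemma not_failsLeft_three (h : IsClockwise x) (h0 : FailsLeft x)
    (h1 : FailsLeft (_root_.shift x 1)) : ¬ FailsLeft (_root_.shift x 2) := by
  intro h2
  have h1 : area (x 4) (x 6) (x 0) * area (x 1) (x 2) (x 3) <
    area (x 1) (x 6) (x 0) * area (x 2) (x 3) (x 4) := h1
  have h2 : area (x 5) (x 0) (x 1) * area (x 2) (x 3) (x 4) <
    area (x 2) (x 0) (x 1) * area (x 3) (x 4) (x 5) := h2
  rw [area_rotate (x 0) (x 1) (x 6), area_rotate (x 0) (x 4) (x 6)] at h1
  rw [← area_rotate (x 2) (x 0) (x 1), ← area_rotate (x 5) (x 0) (x 1)] at h2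
  have p012 := h 0 1 2 (by decide) (by decide)
  have p015 := h 0 1 5 (by decide) (by decide)
  have p014 := h 0 1 4 (by decide) (by decide)
  have p035 := h 0 3 5 (by decide) (by decide)
  have p046 := h 0 4 6 (by decide) (by decide)
  have p056 := h 0 5 6 (by decide) (by decide)
  have p123 := h 1 2 3 (by decide) (by decide)
  have p234 := h 2 3 4 (by decide) (by decide)
  have p356 := h 3 5 6 (by decide) (by decide)
  have p456 := h 4 5 6 (by decide) (by decide)
  have p016 := h 0 1 6 (by decide) (by decide)
  have hlt := mul_mul_lt_of_cyclic (d := area (x 0) (x 1) (x 6))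
    (i := area (x 3) (x 4) (x 5)) p046 p123 p234 p356 p012 p015
    (by linarith) h0 (by linarith)
  have hP : area (x 0) (x 1) (x 5) * area (x 0) (x 4) (x 6) =
      area (x 0) (x 1) (x 4) * area (x 0) (x 5) (x 6) +
        area (x 0) (x 1) (x 6) * area (x 0) (x 4) (x 5) := by
    simp only [area_eq]; ring
  have hQ : area (x 0) (x 4) (x 5) * area (x 3) (x 5) (x 6) =
      area (x 0) (x 5) (x 6) * area (x 3) (x 4) (x 5) +
        area (x 0) (x 3) (x 5) * area (x 4) (x 5) (x 6) := by
    simp only [area_eq]; ring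
  have hpos : 0 < area (x 0) (x 1) (x 4) * area (x 0) (x 5) (x 6) * area (x 3) (x 5) (x 6) +
    area (x 0) (x 1) (x 6) * (area (x 0) (x 3) (x 5) * area (x 4) (x 5) (x 6)) := by positivity
  refine lt_irrefl (0 : ℝ) ?_
  linear_combination hlt + hpos - area (x 3) (x 5) (x 6) * hP - area (x 0) (x 1) (x 6) * hQ

/-- From some vertex, the intersection of the two lines next to it is seen through the opposite
edge. -/
lemma exists_shift_not_fails (h : IsClockwise x) :
    ∃ r, ¬ FailsRight (_root_.shift x r) ∧ ¬ FailsLeft (_root_.shift x r) := by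
  by_contra! H
  have step : ∀ r, FailsRight (_root_.shift x r) → FailsRight (_root_.shift x (4 + r)) := by
    intro r hr
    by_contra hr'
    have := (h.shift r).not_failsLeft_shift_four hr
    rw [shift_shift] at this
    exact this (H _ hr')
  by_cases h0 : ∃ r, FailsRight (_root_.shift x r)
  · obtain ⟨r, hr⟩ := h0
    have key := (h.shift r).not_failsRight_three hr
    rw [shift_shift, shift_shift] at key
    have h4 := step _ hr
    have h1 := step _ h4
    have h5 := step _ h1
    have h2 := step _ h5
    simp only [← add_assoc, Fin.reduceAdd] at h1 h2
    exact key h1 h2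
  · have hL := fun r => H r (fun hr => h0 ⟨r, hr⟩)
    have key := (h.shift 0).not_failsLeft_three (hL 0)
    rw [shift_shift, shift_shift] at key
    exact key (hL _) (hL _)

end IsClockwise

/-- A functional nonnegative on `a`, `b`, `d` is nonnegative on a difference that a linear relation
rewrites as a nonnegative combination, and the difference has positive height. -/
lemma nonneg_and_height_pos {o a b d : Fin 3 → ℝ} {A B C E s t : ℝ} (hA : 0 < A) (hB : 0 < B)
    (hrel : ∀ i, A * o i + B * b i = C * a i + E * d i) (hs : C ≤ s * A) (ht : E ≤ t * A)
    (ho2 : o 2 = 1) (ha2 : a 2 = 1) (hb2 : b 2 = 1) (hd2 : d 2 = 1) :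
    (∀ u : Fin 3 → ℝ, 0 ≤ u ⬝ᵥ a → 0 ≤ u ⬝ᵥ b → 0 ≤ u ⬝ᵥ d → 0 ≤ u ⬝ᵥ (s • a + t • d - o)) ∧
      1 < s + t := by
  constructor
  · intro u ha hb hd
    have key : A * (u ⬝ᵥ (s • a + t • d - o)) =
        (s * A - C) * (u ⬝ᵥ a) + B * (u ⬝ᵥ b) + (t * A - E) * (u ⬝ᵥ d) := by
      simp only [dotProduct, Fin.sum_univ_three, Pi.add_apply, Pi.sub_apply, Pi.smul_apply,
        smul_eq_mul]
      linear_combination (-u 0) * hrel 0 - u 1 * hrel 1 - u 2 * hrel 2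
    refine nonneg_of_mul_nonneg_right (a := A) ?_ hA
    rw [key]
    have := sub_nonneg.2 hs
    have := sub_nonneg.2 ht
    positivity
  · have h2 := hrel 2
    rw [ho2, ha2, hb2, hd2] at h2
    nlinarith

/-- Seven clockwise vectors in good position are, up to scaling, sums `a j + b k` of three and
three vectors of positive height, and all nine sums are in the cone of the seven. -/
lemma IsClockwise.exists_sums {x : Fin 7 → Fin 3 → ℝ} (h : IsClockwise x) (h2 : ∀ i, x i 2 = 1)
    (hR : ¬ FailsRight x) (hL : ¬ FailsLeft x) :
    ∃ a b : Fin 3 → Fin 3 → ℝ, (∀ j, 0 < a j 2) ∧ (∀ k, 0 < b k 2) ∧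
      (∀ u : Fin 3 → ℝ, (∀ i, 0 ≤ u ⬝ᵥ x i) → ∀ j k, 0 ≤ u ⬝ᵥ (a j + b k)) ∧
      ∀ i, ∃ j k, ∃ μ : ℝ, 0 < μ ∧ a j + b k = μ • x i := by
  rw [FailsRight, not_lt] at hR
  rw [FailsLeft, not_lt] at hL
  have p012 := h 0 1 2 (by decide) (by decide)
  have p013 := h 0 1 3 (by decide) (by decide)
  have p014 := h 0 1 4 (by decide) (by decide)
  have p023 := h 0 2 3 (by decide) (by decide)
  have p036 := h 0 3 6 (by decide) (by decide)
  have p045 := h 0 4 5 (by decide) (by decide)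
  have p046 := h 0 4 6 (by decide) (by decide)
  have p056 := h 0 5 6 (by decide) (by decide)
  have p123 := h 1 2 3 (by decide) (by decide)
  have p124 := h 1 2 4 (by decide) (by decide)
  have p234 := h 2 3 4 (by decide) (by decide)
  have p356 := h 3 5 6 (by decide) (by decide)
  have p456 := h 4 5 6 (by decide) (by decide)
  have P1 : area (x 0) (x 2) (x 3) * area (x 1) (x 2) (x 4) =
      area (x 0) (x 2) (x 4) * area (x 1) (x 2) (x 3) +
        area (x 0) (x 1) (x 2) * area (x 2) (x 3) (x 4) := by
    simp only [area_eq]; ring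
  have P2 : area (x 0) (x 4) (x 5) * area (x 3) (x 5) (x 6) =
      area (x 0) (x 3) (x 5) * area (x 4) (x 5) (x 6) +
        area (x 0) (x 5) (x 6) * area (x 3) (x 4) (x 5) := by
    simp only [area_eq]; ring
  have p345 := h 3 4 5 (by decide) (by decide)
  obtain ⟨s₁, hs₁⟩ : ∃ s, s = area (x 0) (x 2) (x 3) / area (x 1) (x 2) (x 3) := ⟨_, rfl⟩
  obtain ⟨s₃, hs₃⟩ : ∃ s, s = area (x 0) (x 1) (x 2) / area (x 1) (x 2) (x 3) := ⟨_, rfl⟩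
  obtain ⟨s₄, hs₄⟩ : ∃ s, s = area (x 0) (x 5) (x 6) / area (x 4) (x 5) (x 6) := ⟨_, rfl⟩
  obtain ⟨s₆, hs₆⟩ : ∃ s, s = area (x 0) (x 4) (x 5) / area (x 4) (x 5) (x 6) := ⟨_, rfl⟩
  have q₁ : 0 < s₁ := by rw [hs₁]; positivity
  have q₃ : 0 < s₃ := by rw [hs₃]; positivity
  have q₄ : 0 < s₄ := by rw [hs₄]; positivity
  have q₆ : 0 < s₆ := by rw [hs₆]; positivity
  obtain ⟨hc, hc2⟩ := nonneg_and_height_pos (s := s₁) (t := s₄) p124 p014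
    (area_cramer (x 0) (x 1) (x 2) (x 4))
    (by rw [hs₁, div_mul_eq_mul_div, le_div_iff₀ p123]; nlinarith [mul_pos p012 p234])
    (by rw [hs₄, div_mul_eq_mul_div, le_div_iff₀ p456]; linarith) (h2 0) (h2 1) (h2 2) (h2 4)
  obtain ⟨hd, hd2⟩ := nonneg_and_height_pos (s := s₃) (t := s₆) p356 p036
    (area_cramer (x 0) (x 3) (x 5) (x 6))
    (by rw [hs₃, div_mul_eq_mul_div, le_div_iff₀ p123]; linarith)
    (by rw [hs₆, div_mul_eq_mul_div, le_div_iff₀ p456]; nlinarith [mul_pos p056 p345])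
    (h2 0) (h2 3) (h2 5) (h2 6)
  have e₂ : s₁ • x 1 + s₃ • x 3 - x 0 =
      (area (x 0) (x 1) (x 3) / area (x 1) (x 2) (x 3)) • x 2 := by
    ext i
    simp only [Pi.add_apply, Pi.sub_apply, Pi.smul_apply, smul_eq_mul, hs₁, hs₃]
    field_simp
    linear_combination -area_cramer (x 0) (x 1) (x 2) (x 3) i
  have e₅ : s₄ • x 4 + s₆ • x 6 - x 0 =
      (area (x 0) (x 4) (x 6) / area (x 4) (x 5) (x 6)) • x 5 := by
    ext i
    simp only [Pi.add_apply, Pi.sub_apply, Pi.smul_apply, smul_eq_mul, hs₄, hs₆]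
    field_simp
    linear_combination -area_cramer (x 0) (x 4) (x 5) (x 6) i
  have m₂ : 0 < area (x 0) (x 1) (x 3) / area (x 1) (x 2) (x 3) := by positivity
  have m₅ : 0 < area (x 0) (x 4) (x 6) / area (x 4) (x 5) (x 6) := by positivity
  have w₂ := congrFun e₂ 2
  have w₅ := congrFun e₅ 2
  simp only [Pi.add_apply, Pi.sub_apply, Pi.smul_apply, smul_eq_mul, h2, mul_one] at w₂ w₅
  obtain ⟨β, hβ, hβ'⟩ : ∃ β, max 0 (max (1 - s₄) (1 - s₃)) < β ∧ β < min 1 (min s₁ s₆) := by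
    apply exists_between
    simp only [max_lt_iff, lt_min_iff]
    refine ⟨⟨by linarith, by linarith, by linarith⟩, ⟨by linarith, by linarith, by linarith⟩,
      by linarith, by linarith, by linarith⟩
  simp only [max_lt_iff, lt_min_iff] at hβ hβ'
  obtain ⟨hβ₀, hβ₄, hβ₃⟩ := hβ
  obtain ⟨hβ₁, hβ₅, hβ₆⟩ := hβ'
  set c : Fin 3 → ℝ := ![0, 0, β] with hc_def
  have hcβ : c 2 = β := by simp [hc_def]
  refine ⟨![s₁ • x 1 - c, s₆ • x 6 - c, x 0 - c],
    ![s₄ • x 4 - (x 0 - c), s₃ • x 3 - (x 0 - c), c], ?_, ?_, ?_, ?_⟩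
  · intro j
    fin_cases j <;> simp [h2, hcβ] <;> assumption
  · intro k
    fin_cases k <;> simp [h2, hcβ] <;> linarith
  · intro u hu
    have r₂ : 0 ≤ u ⬝ᵥ (s₁ • x 1 + s₃ • x 3 - x 0) := by
      rw [e₂, dotProduct_smul]; exact mul_nonneg m₂.le (hu 2)
    have r₅ : 0 ≤ u ⬝ᵥ (s₄ • x 4 + s₆ • x 6 - x 0) := by
      rw [e₅, dotProduct_smul]; exact mul_nonneg m₅.le (hu 5)
    have r₁₄ := hc u (hu 1) (hu 2) (hu 4)
    have r₃₆ := hd u (hu 3) (hu 5) (hu 6)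
    have r₁ := mul_nonneg q₁.le (hu 1)
    have r₃ := mul_nonneg q₃.le (hu 3)
    have r₄ := mul_nonneg q₄.le (hu 4)
    have r₆ := mul_nonneg q₆.le (hu 6)
    have r₀ := hu 0
    simp only [dotProduct_add, dotProduct_sub, dotProduct_smul, smul_eq_mul] at r₂ r₅ r₁₄ r₃₆
    intro j k
    fin_cases j <;> fin_cases k <;>
      simp [dotProduct_add, dotProduct_sub, dotProduct_smul] <;> linarith
  · intro i
    fin_cases i
    · exact ⟨2, 2, 1, one_pos, by simp⟩
    · exact ⟨0, 2, s₁, q₁, by simp⟩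
    · exact ⟨0, 1, _, m₂, by refine Eq.trans ?_ e₂; simp; abel⟩
    · exact ⟨2, 1, s₃, q₃, by simp⟩
    · exact ⟨2, 0, s₄, q₄, by simp⟩
    · exact ⟨1, 0, _, m₅, by refine Eq.trans ?_ e₅; simp; abel⟩
    · exact ⟨1, 2, s₆, q₆, by simp⟩

/-- The embedding of the plane in space at height zero. -/
noncomputable def planeEmbedding : (Fin 2 → ℝ) →ₗ[ℝ] (Fin 3 → ℝ) where
  toFun v := ![v 0, v 1, 0]
  map_add' v w := by ext i; fin_cases i <;> simp
  map_smul' c v := by ext i; fin_cases i <;> simp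

lemma planeEmbedding_injective : Function.Injective planeEmbedding := by
  intro v w hvw
  have h0 := congrFun hvw 0
  have h1 := congrFun hvw 1
  simp only [planeEmbedding, LinearMap.coe_mk, AddHom.coe_mk] at h0 h1
  ext i
  fin_cases i
  · simpa using h0
  · simpa using h1

/-- A point outside the convex hull of finitely many points is separated from them by a linear
functional on homogeneous coordinates. -/
lemma exists_dotProduct_hat_neg {n : ℕ} (p : Fin n → Fin 2 → ℝ) {y : Fin 2 → ℝ}
    (hy : y ∉ convexHull ℝ (Set.range p)) :
    ∃ u : Fin 3 → ℝ, (∀ k, 0 ≤ u ⬝ᵥ hat (p k)) ∧ u ⬝ᵥ hat y < 0 := by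
  obtain ⟨g, c, hg, hgy⟩ := geometric_hahn_banach_closed_point (convex_convexHull ℝ (Set.range p))
    ((Set.finite_range p).isClosed_convexHull ℝ) hy
  have key : ∀ v : Fin 2 → ℝ,
      ![-g (Pi.single 0 1), -g (Pi.single 1 1), c] ⬝ᵥ hat v = c - g v := by
    intro v
    have hv : v = v 0 • Pi.single 0 1 + v 1 • Pi.single 1 1 := by
      ext i; fin_cases i <;> simp
    have hgv : g v = v 0 * g (Pi.single 0 1) + v 1 * g (Pi.single 1 1) := by
      conv_lhs => rw [hv]
      simp
    rw [hgv]
    simp [dotProduct, Fin.sum_univ_three, hat]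
    ring
  refine ⟨![-g (Pi.single 0 1), -g (Pi.single 1 1), c], fun k => ?_, ?_⟩
  · rw [key]
    exact sub_nonneg.2 (hg _ (subset_convexHull ℝ _ (Set.mem_range_self k))).le
  · rw [key]
    exact sub_neg.2 hgy

/-- The point of space with homogeneous coordinates `v 0, v 1, ε, v 2`. -/
noncomputable def heightPoint (ε : ℝ) (v : Fin 3 → ℝ) : Fin 3 → ℝ :=
  ![v 0 / v 2, v 1 / v 2, ε / v 2]

/-- If all sums `a j + b k` lie in the cone over a polygon and the sums hit the rays of the
vertices in `S`, then the polygon is a section of the convex hull of the lifted `a j` above, the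
lifted `b k` below and the remaining vertices. -/
lemma exists_section_of_sums {n : ℕ} (p : Fin n → Fin 2 → ℝ) (S : Finset (Fin n))
    (a b : Fin 3 → Fin 3 → ℝ) (ha : ∀ j, 0 < a j 2) (hb : ∀ k, 0 < b k 2)
    (hcone : ∀ u : Fin 3 → ℝ, (∀ i, 0 ≤ u ⬝ᵥ hat (p i)) → ∀ j k, 0 ≤ u ⬝ᵥ (a j + b k))
    (hhit : ∀ i ∈ S, ∃ j k, ∃ μ : ℝ, 0 < μ ∧ a j + b k = μ • hat (p i)) :
    ∃ (V : Finset (Fin 3 → ℝ)) (f : (Fin 2 → ℝ) →ᵃ[ℝ] (Fin 3 → ℝ)),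
      V.card ≤ 6 + (n - S.card) ∧ Function.Injective f ∧
      convexHull ℝ (V : Set (Fin 3 → ℝ)) ∩ Set.range f =
        f '' (convexHull ℝ (Set.range p)) := by
  classical
  set V : Finset (Fin 3 → ℝ) := (Finset.univ.image fun j => heightPoint 1 (a j)) ∪
    (Finset.univ.image fun k => heightPoint (-1) (b k)) ∪
    Sᶜ.image fun i => planeEmbedding (p i) with hV
  have hVa : ∀ j, heightPoint 1 (a j) ∈ convexHull ℝ (V : Set (Fin 3 → ℝ)) := fun j =>
    subset_convexHull ℝ _ (by simp [hV])
  have hVb : ∀ k, heightPoint (-1) (b k) ∈ convexHull ℝ (V : Set (Fin 3 → ℝ)) := fun k =>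
    subset_convexHull ℝ _ (by simp [hV])
  refine ⟨V, planeEmbedding.toAffineMap, ?_, planeEmbedding_injective, ?_⟩
  · have h1 := Finset.card_image_le (s := (Finset.univ : Finset (Fin 3)))
      (f := fun j => heightPoint 1 (a j))
    have h2 := Finset.card_image_le (s := (Finset.univ : Finset (Fin 3)))
      (f := fun k => heightPoint (-1) (b k))
    have h3 := Finset.card_image_le (s := Sᶜ) (f := fun i => planeEmbedding (p i))
    rw [Finset.card_compl, Fintype.card_fin] at h3
    rw [Finset.card_univ, Fintype.card_fin] at h1 h2
    refine (Finset.card_union_le _ _).trans ?_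
    have := Finset.card_union_le (Finset.univ.image fun j => heightPoint 1 (a j))
      (Finset.univ.image fun k => heightPoint (-1) (b k))
    omega
  refine Set.Subset.antisymm ?_ ?_
  · rintro _ ⟨hx, y, rfl⟩
    refine ⟨y, ?_, rfl⟩
    by_contra hy
    obtain ⟨u, hu, huy⟩ := exists_dotProduct_hat_neg p hy
    obtain ⟨j₀, -, hj₀⟩ := Finset.exists_min_image Finset.univ (fun j => u ⬝ᵥ a j)
      Finset.univ_nonempty
    set c := u ⬝ᵥ a j₀
    have hH : Convex ℝ {x : Fin 3 → ℝ | -u 2 ≤ ![u 0, u 1, -c] ⬝ᵥ x} :=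
      convex_halfSpace_ge (f := fun x => ![u 0, u 1, -c] ⬝ᵥ x)
        ⟨fun x y => dotProduct_add _ x y, fun r x => dotProduct_smul r _ x⟩ _
    have hsub : (V : Set (Fin 3 → ℝ)) ⊆ {x : Fin 3 → ℝ | -u 2 ≤ ![u 0, u 1, -c] ⬝ᵥ x} := by
      intro x hx
      simp only [hV, Finset.coe_union, Finset.coe_image, Set.mem_union, Set.mem_image,
        Finset.mem_coe, Finset.mem_univ, true_and, Finset.mem_compl] at hx
      rw [Set.mem_ofPred_eq, neg_le_iff_add_nonneg]
      rcases hx with (⟨j, rfl⟩ | ⟨k, rfl⟩) | ⟨i, -, rfl⟩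
      · have hj := hj₀ j (Finset.mem_univ j)
        have : ![u 0, u 1, -c] ⬝ᵥ heightPoint 1 (a j) + u 2 = (u ⬝ᵥ a j - c) / a j 2 := by
          have := (ha j).ne'
          simp [dotProduct, Fin.sum_univ_three, heightPoint]
          field_simp
          ring
        rw [this]
        exact div_nonneg (sub_nonneg.2 hj) (ha j).le
      · have hk := hcone u hu j₀ k
        rw [dotProduct_add] at hk
        have : ![u 0, u 1, -c] ⬝ᵥ heightPoint (-1) (b k) + u 2 = (c + u ⬝ᵥ b k) / b k 2 := by
          have := (hb k).ne'
          simp [dotProduct, Fin.sum_univ_three, heightPoint]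
          field_simp
          ring
        rw [this]
        exact div_nonneg hk (hb k).le
      · simpa [dotProduct, Fin.sum_univ_three, planeEmbedding, hat] using hu i
    have hmem := convexHull_min hsub hH hx
    simp [dotProduct, Fin.sum_univ_three, planeEmbedding, hat] at hmem huy
    linarith
  · rintro _ ⟨y, hy, rfl⟩
    refine ⟨?_, y, rfl⟩
    rw [LinearMap.coe_toAffineMap]
    suffices hsub : planeEmbedding '' Set.range p ⊆ convexHull ℝ (V : Set (Fin 3 → ℝ)) by
      have := convexHull_min hsub (convex_convexHull ℝ _)
      rw [← planeEmbedding.image_convexHull] at this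
      exact this ⟨y, hy, rfl⟩
    rintro _ ⟨_, ⟨i, rfl⟩, rfl⟩
    by_cases hi : i ∈ S
    · obtain ⟨j, k, μ, hμ, hjk⟩ := hhit i hi
      have e0 : a j 0 + b k 0 = μ * p i 0 := by simpa [hat] using congrFun hjk 0
      have e1 : a j 1 + b k 1 = μ * p i 1 := by simpa [hat] using congrFun hjk 1
      have e2 : a j 2 + b k 2 = μ := by simpa [hat] using congrFun hjk 2
      have hcomb : planeEmbedding (p i) =
          (a j 2 / μ) • heightPoint 1 (a j) + (b k 2 / μ) • heightPoint (-1) (b k) := by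
        have := (ha j).ne'
        have := (hb k).ne'
        ext l
        fin_cases l <;> simp [planeEmbedding, heightPoint] <;> field_simp <;> linarith
      rw [hcomb]
      exact convex_convexHull ℝ _ (hVa j) (hVb k) (div_nonneg (ha j).le hμ.le)
        (div_nonneg (hb k).le hμ.le) (by rw [← add_div, e2, div_self hμ.ne'])
    · refine subset_convexHull ℝ _ ?_
      simp only [hV, Finset.coe_union, Finset.coe_image]
      exact Or.inr ⟨i, by simpa using hi, rfl⟩

/-- Every `n`-gon with `n ≥ 7` is a section of a 3-polytope with at most `n − 1`
vertices. -/
theorem ngon_section_of_3polytope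
    (n : ℕ) (hn : 7 ≤ n) (p : Fin n → Fin 2 → ℝ)
    (hconv : ∀ i j k : Fin n, i < j → j < k →
      det3 (hat (p i)) (hat (p j)) (hat (p k)) < 0) :
    ∃ (V : Finset (Fin 3 → ℝ)) (f : (Fin 2 → ℝ) →ᵃ[ℝ] (Fin 3 → ℝ)),
      V.card ≤ n - 1 ∧ Function.Injective f ∧
      convexHull ℝ (V : Set (Fin 3 → ℝ)) ∩ Set.range f =
        f '' (convexHull ℝ (Set.range p)) := by
  have hcw : IsClockwise fun i => hat (p (Fin.castLE hn i)) := fun i j k hij hjk =>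
    neg_pos.2 (hconv _ _ _ ((Fin.castLE_lt_castLE_iff hn).2 hij)
      ((Fin.castLE_lt_castLE_iff hn).2 hjk))
  obtain ⟨r, hR, hL⟩ := hcw.exists_shift_not_fails
  obtain ⟨a, b, ha, hb, hcone, hhit⟩ :=
    (hcw.shift r).exists_sums (fun i => by simp [shift, hat]) hR hL
  obtain ⟨V, f, hcard, hf, hsec⟩ := exists_section_of_sums p
    (Finset.univ.map (Fin.castLEEmb hn)) a b ha hb (fun u hu => hcone u fun i => hu _) (by
      intro i hi
      obtain ⟨k, -, rfl⟩ := Finset.mem_map.1 hi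
      have := hhit (k - r)
      simp only [shift, sub_add_cancel] at this
      exact this)
  refine ⟨V, f, ?_, hf, hsec⟩
  rw [Finset.card_map, Finset.card_univ, Fintype.card_fin] at hcard
  omega
end

section
/- Sections of convex hulls of unions: let d ≤ d_1 and d ≤ d_2, and let P_1, P_2 ⊆ ℝ^d be convex hulls of finite sets. Suppose for i = 1, 2 there are a finite set V_i ⊆ ℝ^{d_i} with |V_i| ≤ n_i and an injective affine map f_i : ℝ^d → ℝ^{d_i} such that conv(V_i) ∩ range(f_i) = f_i(P_i). Then there exist a finite set V ⊆ ℝ^{d_1 + d_2 − d} with |V| ≤ n_1 + n_2 and an injective affine map f : ℝ^d → ℝ^{d_1 + d_2 − d} such that conv(V) ∩ range(f) = f(conv(P_1 ∪ P_2)). -/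
/-- An injective affine map has an affine retraction, together with an affine map to a complement
whose zero set is the range. -/
lemma AffineMap.exists_retraction_and_equation {E M : Type*} [AddCommGroup E] [Module ℝ E]
    [AddCommGroup M] [Module ℝ M] (f : M →ᵃ[ℝ] E) (hf : Function.Injective f) :
    ∃ (r : E →ᵃ[ℝ] M) (q : E →ᵃ[ℝ] E ⧸ LinearMap.range f.linear),
      (∀ x, r (f x) = x) ∧ ∀ v, q v = 0 ↔ v ∈ Set.range f := by
  have hinj : Function.Injective f.linear := f.linear_injective_iff.mpr hf
  obtain ⟨ρ, hρ⟩ := f.linear.exists_leftInverse_of_injective (LinearMap.ker_eq_bot.mpr hinj)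
  have hsub : ∀ x, f x - f 0 = f.linear x := fun x => by
    simpa using (f.linearMap_vsub x 0).symm
  let τ : E →ᵃ[ℝ] E := AffineMap.id ℝ E - AffineMap.const ℝ E (f 0)
  have hτ : ∀ v, τ v = v - f 0 := fun v => by simp [τ]
  refine ⟨ρ.toAffineMap.comp τ, (Submodule.mkQ _).toAffineMap.comp τ, fun x => ?_, fun v => ?_⟩
  · simpa [hτ, hsub] using LinearMap.congr_fun hρ x
  · simp only [AffineMap.comp_apply, hτ, LinearMap.coe_toAffineMap, Submodule.mkQ_apply,
      Submodule.Quotient.mk_eq_zero, LinearMap.mem_range, Set.mem_range, ← hsub, sub_left_inj]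

/-- Placing two convex hulls in complementary directions over a common space `M`, the section
of the joint convex hull by `M` is the convex hull of the union of the two sections. -/
lemma convexHull_union_inter_range_inl {E₁ E₂ M Q₁ Q₂ : Type*}
    [AddCommGroup E₁] [Module ℝ E₁] [AddCommGroup E₂] [Module ℝ E₂]
    [AddCommGroup M] [Module ℝ M] [AddCommGroup Q₁] [Module ℝ Q₁] [AddCommGroup Q₂] [Module ℝ Q₂]
    (A₁ : Set E₁) (A₂ : Set E₂)
    (r₁ : E₁ →ᵃ[ℝ] M) (q₁ : E₁ →ᵃ[ℝ] Q₁) (r₂ : E₂ →ᵃ[ℝ] M) (q₂ : E₂ →ᵃ[ℝ] Q₂) :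
    convexHull ℝ ((r₁.prod (q₁.prod (0 : E₁ →ᵃ[ℝ] Q₂))) '' A₁ ∪
        (r₂.prod ((0 : E₂ →ᵃ[ℝ] Q₁).prod q₂)) '' A₂) ∩
        Set.range (LinearMap.inl ℝ M (Q₁ × Q₂)) =
      LinearMap.inl ℝ M (Q₁ × Q₂) '' convexHull ℝ
        (r₁ '' (convexHull ℝ A₁ ∩ {v | q₁ v = 0}) ∪ r₂ '' (convexHull ℝ A₂ ∩ {v | q₂ v = 0})) := by
  set φ₁ := r₁.prod (q₁.prod (0 : E₁ →ᵃ[ℝ] Q₂))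
  set φ₂ := r₂.prod ((0 : E₂ →ᵃ[ℝ] Q₁).prod q₂)
  set R₁ := r₁ '' (convexHull ℝ A₁ ∩ {v | q₁ v = 0})
  set R₂ := r₂ '' (convexHull ℝ A₂ ∩ {v | q₂ v = 0})
  have e₁ : ∀ v, φ₁ v = (r₁ v, q₁ v, 0) := fun v => rfl
  have e₂ : ∀ v, φ₂ v = (r₂ v, 0, q₂ v) := fun v => rfl
  have mem₁ : ∀ v ∈ convexHull ℝ A₁, q₁ v = 0 → r₁ v ∈ convexHull ℝ (R₁ ∪ R₂) :=
    fun v hv h => subset_convexHull ℝ _ (Or.inl ⟨v, ⟨hv, h⟩, rfl⟩)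
  have mem₂ : ∀ v ∈ convexHull ℝ A₂, q₂ v = 0 → r₂ v ∈ convexHull ℝ (R₁ ∪ R₂) :=
    fun v hv h => subset_convexHull ℝ _ (Or.inr ⟨v, ⟨hv, h⟩, rfl⟩)
  apply Set.Subset.antisymm
  · rintro _ ⟨hz, x, rfl⟩
    refine ⟨x, ?_, rfl⟩
    rcases A₁.eq_empty_or_nonempty with rfl | hA₁
    · rw [Set.image_empty, Set.empty_union, ← AffineMap.image_convexHull] at hz
      obtain ⟨v, hv, h⟩ := hz
      simp only [e₂, LinearMap.inl_apply, Prod.ext_iff, Prod.fst_zero, Prod.snd_zero] at h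
      exact h.1 ▸ mem₂ v hv h.2.2
    rcases A₂.eq_empty_or_nonempty with rfl | hA₂
    · rw [Set.image_empty, Set.union_empty, ← AffineMap.image_convexHull] at hz
      obtain ⟨v, hv, h⟩ := hz
      simp only [e₁, LinearMap.inl_apply, Prod.ext_iff, Prod.fst_zero, Prod.snd_zero] at h
      exact h.1 ▸ mem₁ v hv h.2.1
    rw [convexHull_union (hA₁.image _) (hA₂.image _), ← AffineMap.image_convexHull,
      ← AffineMap.image_convexHull, mem_convexJoin] at hz
    obtain ⟨_, ⟨v, hv, rfl⟩, _, ⟨w, hw, rfl⟩, a, b, ha, hb, hab, h⟩ := hz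
    simp only [e₁, e₂, LinearMap.inl_apply, Prod.ext_iff, Prod.fst_add, Prod.snd_add,
      Prod.smul_fst, Prod.smul_snd, Prod.fst_zero, Prod.snd_zero, smul_zero, add_zero, zero_add,
      smul_eq_zero] at h
    obtain ⟨rfl, hv0, hw0⟩ := h
    rcases hv0 with rfl | hv0
    · obtain rfl : b = 1 := by linarith
      simpa using mem₂ w hw (by simpa using hw0)
    rcases hw0 with rfl | hw0
    · obtain rfl : a = 1 := by linarith
      simpa using mem₁ v hv hv0
    exact convex_convexHull ℝ _ (mem₁ v hv hv0) (mem₂ w hw hw0) ha hb hab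
  · refine Set.subset_inter ?_ (Set.image_subset_range _ _)
    rw [LinearMap.image_convexHull]
    refine convexHull_min ?_ (convex_convexHull ℝ _)
    rintro _ ⟨_, ⟨v, ⟨hv, h⟩, rfl⟩ | ⟨v, ⟨hv, h⟩, rfl⟩, rfl⟩
    · refine convexHull_mono Set.subset_union_left ?_
      rw [← AffineMap.image_convexHull]
      exact ⟨v, hv, by rw [e₁, h.out]; rfl⟩
    · refine convexHull_mono Set.subset_union_right ?_
      rw [← AffineMap.image_convexHull]
      exact ⟨v, hv, by rw [e₂, h.out]; rfl⟩

/-- Sections of convex hulls of unions: if `Pᵢ ⊆ ℝ^d` is a polytope that is a section of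
a polytope with at most `nᵢ` vertices in `ℝ^{dᵢ}` (for `i = 1, 2`), then
`conv(P₁ ∪ P₂)` is a section of a polytope with at most `n₁ + n₂` vertices in
`ℝ^{d₁ + d₂ − d}`. -/
theorem section_of_convexHull_union
    (d d₁ d₂ n₁ n₂ : ℕ) (hd₁ : d ≤ d₁) (hd₂ : d ≤ d₂)
    (S₁ S₂ : Finset (Fin d → ℝ))
    (P₁ P₂ : Set (Fin d → ℝ))
    (hP₁ : P₁ = convexHull ℝ (S₁ : Set (Fin d → ℝ)))
    (hP₂ : P₂ = convexHull ℝ (S₂ : Set (Fin d → ℝ)))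
    (V₁ : Finset (Fin d₁ → ℝ)) (f₁ : (Fin d → ℝ) →ᵃ[ℝ] (Fin d₁ → ℝ))
    (hV₁ : V₁.card ≤ n₁) (hf₁ : Function.Injective f₁)
    (hsec₁ : convexHull ℝ (V₁ : Set (Fin d₁ → ℝ)) ∩ Set.range f₁ = f₁ '' P₁)
    (V₂ : Finset (Fin d₂ → ℝ)) (f₂ : (Fin d → ℝ) →ᵃ[ℝ] (Fin d₂ → ℝ))
    (hV₂ : V₂.card ≤ n₂) (hf₂ : Function.Injective f₂)
    (hsec₂ : convexHull ℝ (V₂ : Set (Fin d₂ → ℝ)) ∩ Set.range f₂ = f₂ '' P₂) :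
    ∃ (V : Finset (Fin (d₁ + d₂ - d) → ℝ))
      (f : (Fin d → ℝ) →ᵃ[ℝ] (Fin (d₁ + d₂ - d) → ℝ)),
      V.card ≤ n₁ + n₂ ∧ Function.Injective f ∧
      convexHull ℝ (V : Set (Fin (d₁ + d₂ - d) → ℝ)) ∩ Set.range f =
        f '' (convexHull ℝ (P₁ ∪ P₂)) := by
  classical
  obtain ⟨r₁, q₁, hr₁, hq₁⟩ := f₁.exists_retraction_and_equation hf₁
  obtain ⟨r₂, q₂, hr₂, hq₂⟩ := f₂.exists_retraction_and_equation hf₂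
  have key := convexHull_union_inter_range_inl (V₁ : Set (Fin d₁ → ℝ)) (V₂ : Set (Fin d₂ → ℝ))
    r₁ q₁ r₂ q₂
  have s₁ : {v | q₁ v = 0} = Set.range f₁ := Set.ext hq₁
  have s₂ : {v | q₂ v = 0} = Set.range f₂ := Set.ext hq₂
  rw [s₁, s₂, hsec₁, hsec₂, Set.image_image, Set.image_image] at key
  simp only [hr₁, hr₂, Set.image_id'] at key
  set φ₁ := r₁.prod (q₁.prod (0 : _ →ᵃ[ℝ] (Fin d₂ → ℝ) ⧸ LinearMap.range f₂.linear))
  set φ₂ := r₂.prod ((0 : _ →ᵃ[ℝ] (Fin d₁ → ℝ) ⧸ LinearMap.range f₁.linear).prod q₂)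
  have hl₁ := Submodule.finrank_quotient_add_finrank (LinearMap.range f₁.linear)
  have hl₂ := Submodule.finrank_quotient_add_finrank (LinearMap.range f₂.linear)
  rw [LinearMap.finrank_range_of_inj (f₁.linear_injective_iff.mpr hf₁), Module.finrank_fin_fun,
    Module.finrank_fin_fun] at hl₁
  rw [LinearMap.finrank_range_of_inj (f₂.linear_injective_iff.mpr hf₂), Module.finrank_fin_fun,
    Module.finrank_fin_fun] at hl₂
  let e : ((Fin d → ℝ) × ((Fin d₁ → ℝ) ⧸ LinearMap.range f₁.linear) ×
      ((Fin d₂ → ℝ) ⧸ LinearMap.range f₂.linear)) ≃ₗ[ℝ] (Fin (d₁ + d₂ - d) → ℝ) :=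
    LinearEquiv.ofFinrankEq _ _ (by
      simp only [Module.finrank_prod, Module.finrank_fin_fun]
      omega)
  refine ⟨(V₁.image φ₁ ∪ V₂.image φ₂).image e,
    (e.toLinearMap ∘ₗ LinearMap.inl ℝ _ _).toAffineMap, ?_, ?_, ?_⟩
  · exact Finset.card_image_le.trans ((Finset.card_union_le _ _).trans
      (add_le_add (Finset.card_image_le.trans hV₁) (Finset.card_image_le.trans hV₂)))
  · exact e.injective.comp LinearMap.inl_injective
  · have key' := congrArg (fun s => e '' s) key
    simp only [Set.image_inter e.injective, ← Set.range_comp, Set.image_image] at key'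
    rw [← LinearEquiv.coe_coe, LinearMap.image_convexHull] at key'
    simp only [Finset.coe_image, Finset.coe_union]
    exact key'
end

section
/- Let M be an n×m real matrix with nonnegative entries and rank exactly 3. Then the nonnegative rank of M is at most ⌈6·min(n, m)/7⌉; that is, there exist a natural number r ≤ ⌈6·min(n, m)/7⌉, an n×r matrix R with nonnegative entries, and an r×m matrix S with nonnegative entries such that M = R·S. -/
open Matrix

/-- The determinant of three vectors of `ℝ³`, seen as the orientation of a triangle in the
projective plane. -/
def orient (a b c : Fin 3 → ℝ) : ℝ := Matrix.det (Matrix.of ![a, b, c])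

lemma orient_eq (a b c : Fin 3 → ℝ) :
    orient a b c = a 0 * b 1 * c 2 - a 0 * b 2 * c 1 - a 1 * b 0 * c 2 + a 1 * b 2 * c 0
      + a 2 * b 0 * c 1 - a 2 * b 1 * c 0 := by
  exact Matrix.det_fin_three (Matrix.of ![a, b, c])

lemma orient_rotate (a b c : Fin 3 → ℝ) : orient a b c = orient b c a := by
  simp only [orient_eq]; ring

lemma orient_swap (a b c : Fin 3 → ℝ) : orient a c b = -orient a b c := by
  simp only [orient_eq]; ring

/-- Cramer's rule for four vectors of `ℝ³`. -/
lemma orient_smul_relation (a b c d : Fin 3 → ℝ) :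
    orient b c d • a + orient a b d • c = orient a c d • b + orient a b c • d := by
  ext i
  fin_cases i <;> simp [orient_eq] <;> ring

lemma orient_dotProduct_relation (a b c d x : Fin 3 → ℝ) :
    orient b c d * (a ⬝ᵥ x) + orient a b d * (c ⬝ᵥ x) =
      orient a c d * (b ⬝ᵥ x) + orient a b c * (d ⬝ᵥ x) := by
  simpa only [add_dotProduct, smul_dotProduct, smul_eq_mul] using
    congrArg (· ⬝ᵥ x) (orient_smul_relation a b c d)

/-- The vectors `v 0, …, v 6` span, in this cyclic order, the extreme rays of a convex cone. -/
def IsConvexHeptagon (v : Fin 7 → Fin 3 → ℝ) : Prop :=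
  ∀ i j k, i < j → j < k → 0 < orient (v i) (v j) (v k)

lemma IsConvexHeptagon.rotate_one {v : Fin 7 → Fin 3 → ℝ} (hv : IsConvexHeptagon v) :
    IsConvexHeptagon fun i => v (i + 1) := by
  intro i j k hij hjk
  have key : ∀ i j k : Fin 7, i < j → j < k →
      (i + 1 < j + 1 ∧ j + 1 < k + 1) ∨ (k + 1 < i + 1 ∧ i + 1 < j + 1) := by decide
  obtain ⟨h₁, h₂⟩ | ⟨h₁, h₂⟩ := key i j k hij hjk
  · exact hv _ _ _ h₁ h₂
  · rw [← orient_rotate]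
    exact hv _ _ _ h₁ h₂

lemma IsConvexHeptagon.rotate {v : Fin 7 → Fin 3 → ℝ} (hv : IsConvexHeptagon v) (c : Fin 7) :
    IsConvexHeptagon fun i => v (i + c) := by
  induction c using Fin.induction with
  | zero => simpa using hv
  | succ c ih =>
    convert ih.rotate_one using 3
    rw [← Fin.coeSucc_eq_succ]
    abel

/-- The condition that `v 0 - v 1 + v 2`, with the vectors suitably scaled, is on the inner side of
the edge from `v 6` to `v 0`. -/
def LeftCond (v : Fin 7 → Fin 3 → ℝ) : Prop :=
  orient (v 2) (v 3) (v 4) * orient (v 0) (v 5) (v 6) ≤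
    orient (v 3) (v 4) (v 5) * orient (v 0) (v 2) (v 6)

/-- The mirror image of `LeftCond`. -/
def RightCond (v : Fin 7 → Fin 3 → ℝ) : Prop :=
  orient (v 0) (v 1) (v 6) * orient (v 3) (v 4) (v 5) ≤
    orient (v 0) (v 5) (v 6) * orient (v 1) (v 3) (v 4)

lemma IsConvexHeptagon.leftCond_rotate_three {v : Fin 7 → Fin 3 → ℝ} (hv : IsConvexHeptagon v)
    (hr : ¬ RightCond v) : LeftCond fun i => v (i + 3) := by
  by_contra hl
  have hr' : orient (v 0) (v 5) (v 6) * orient (v 1) (v 3) (v 4) <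
      orient (v 0) (v 1) (v 6) * orient (v 3) (v 4) (v 5) := not_le.1 hr
  have hl' : orient (v 6) (v 0) (v 1) * orient (v 3) (v 5) (v 2) <
      orient (v 5) (v 6) (v 0) * orient (v 3) (v 1) (v 2) := not_le.1 hl
  rw [orient_rotate (v 6), orient_rotate (v 3) (v 5), orient_rotate (v 5) (v 2),
    orient_rotate (v 5), orient_rotate (v 6), orient_rotate (v 3) (v 1)] at hl'
  have h₀ := hv 0 5 6 (by decide) (by decide)
  have h₁ := hv 1 3 4 (by decide) (by decide)
  have h₂ := hv 0 1 6 (by decide) (by decide)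
  have h₃ := hv 2 3 5 (by decide) (by decide)
  have h₄ := hv 2 3 4 (by decide) (by decide)
  have h₅ := hv 1 3 5 (by decide) (by decide)
  have plucker : orient (v 1) (v 3) (v 4) * orient (v 2) (v 3) (v 5) =
      orient (v 3) (v 4) (v 5) * orient (v 1) (v 2) (v 3) +
        orient (v 2) (v 3) (v 4) * orient (v 1) (v 3) (v 5) := by
    simp only [orient_eq]; ring
  have h := mul_lt_mul'' hr' hl' (by positivity) (by positivity)
  have h' : 0 ≤ orient (v 0) (v 5) (v 6) * orient (v 0) (v 1) (v 6) *
      (orient (v 2) (v 3) (v 4) * orient (v 1) (v 3) (v 5)) := by positivity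
  refine lt_irrefl (0 : ℝ) ?_
  linear_combination h + h' -
    orient (v 0) (v 5) (v 6) * orient (v 0) (v 1) (v 6) * plucker

lemma IsConvexHeptagon.exists_rightCond {v : Fin 7 → Fin 3 → ℝ} (hv : IsConvexHeptagon v) :
    RightCond v ∨ RightCond (fun i => v (i + 1)) ∨ RightCond (fun i => v (i + 2)) := by
  by_contra! ⟨ha, hb, hc⟩
  have ha' : orient (v 0) (v 5) (v 6) * orient (v 1) (v 3) (v 4) <
      orient (v 0) (v 1) (v 6) * orient (v 3) (v 4) (v 5) := not_le.1 ha
  have hb' : orient (v 1) (v 6) (v 0) * orient (v 2) (v 4) (v 5) <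
      orient (v 1) (v 2) (v 0) * orient (v 4) (v 5) (v 6) := not_le.1 hb
  have hc' : orient (v 2) (v 0) (v 1) * orient (v 3) (v 5) (v 6) <
      orient (v 2) (v 3) (v 1) * orient (v 5) (v 6) (v 0) := not_le.1 hc
  rw [← orient_rotate (v 0) (v 1) (v 6), ← orient_rotate (v 0) (v 1) (v 2)] at hb'
  rw [orient_rotate (v 2) (v 0), ← orient_rotate (v 1) (v 2), ← orient_rotate (v 0) (v 5)] at hc'
  have h₀ := hv 0 5 6 (by decide) (by decide)
  have h₁ := hv 0 1 6 (by decide) (by decide)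
  have h₂ := hv 0 1 2 (by decide) (by decide)
  have h₃ := hv 1 3 4 (by decide) (by decide)
  have h₄ := hv 2 4 5 (by decide) (by decide)
  have h₅ := hv 3 5 6 (by decide) (by decide)
  have h₆ := hv 2 3 4 (by decide) (by decide)
  have h₇ := hv 1 3 5 (by decide) (by decide)
  have h₈ := hv 4 5 6 (by decide) (by decide)
  have h₉ := hv 2 5 6 (by decide) (by decide)
  have h₁₀ := hv 3 4 5 (by decide) (by decide)
  have plucker₁ : orient (v 1) (v 3) (v 4) * orient (v 2) (v 3) (v 5) =
      orient (v 3) (v 4) (v 5) * orient (v 1) (v 2) (v 3) +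
        orient (v 2) (v 3) (v 4) * orient (v 1) (v 3) (v 5) := by
    simp only [orient_eq]; ring
  have plucker₂ : orient (v 3) (v 5) (v 6) * orient (v 2) (v 4) (v 5) =
      orient (v 4) (v 5) (v 6) * orient (v 2) (v 3) (v 5) +
        orient (v 2) (v 5) (v 6) * orient (v 3) (v 4) (v 5) := by
    simp only [orient_eq]; ring
  obtain ⟨K, hK⟩ : ∃ K, K = orient (v 0) (v 5) (v 6) * orient (v 0) (v 1) (v 6) *
    orient (v 0) (v 1) (v 2) := ⟨_, rfl⟩
  have K_nonneg : 0 ≤ K := by rw [hK]; positivity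
  have h := mul_lt_mul'' (mul_lt_mul'' ha' hb' (by positivity) (by positivity)) hc'
    (by positivity) (by positivity)
  have h' : 0 ≤ K * (orient (v 4) (v 5) (v 6) *
      (orient (v 2) (v 3) (v 4) * orient (v 1) (v 3) (v 5)) + orient (v 1) (v 3) (v 4) *
      (orient (v 2) (v 5) (v 6) * orient (v 3) (v 4) (v 5))) := by positivity
  subst hK
  refine lt_irrefl (0 : ℝ) ?_
  linear_combination h + h' - orient (v 0) (v 5) (v 6) * orient (v 0) (v 1) (v 6) *
    orient (v 0) (v 1) (v 2) * (orient (v 4) (v 5) (v 6) * plucker₁ +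
      orient (v 1) (v 3) (v 4) * plucker₂)

lemma IsConvexHeptagon.exists_leftCond {v : Fin 7 → Fin 3 → ℝ} (hv : IsConvexHeptagon v) :
    LeftCond v ∨ LeftCond (fun i => v (i + 1)) ∨ LeftCond (fun i => v (i + 2)) := by
  by_contra! ⟨ha, hb, hc⟩
  have ha' : orient (v 3) (v 4) (v 5) * orient (v 0) (v 2) (v 6) <
      orient (v 2) (v 3) (v 4) * orient (v 0) (v 5) (v 6) := not_le.1 ha
  have hb' : orient (v 4) (v 5) (v 6) * orient (v 1) (v 3) (v 0) <
      orient (v 3) (v 4) (v 5) * orient (v 1) (v 6) (v 0) := not_le.1 hb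
  have hc' : orient (v 5) (v 6) (v 0) * orient (v 2) (v 4) (v 1) <
      orient (v 4) (v 5) (v 6) * orient (v 2) (v 0) (v 1) := not_le.1 hc
  rw [← orient_rotate (v 0) (v 1) (v 3), ← orient_rotate (v 0) (v 1) (v 6)] at hb'
  rw [orient_rotate (v 2) (v 0), ← orient_rotate (v 1) (v 2), ← orient_rotate (v 0) (v 5)] at hc'
  have h₀ := hv 3 4 5 (by decide) (by decide)
  have h₁ := hv 4 5 6 (by decide) (by decide)
  have h₂ := hv 0 5 6 (by decide) (by decide)
  have h₃ := hv 0 2 6 (by decide) (by decide)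
  have h₄ := hv 0 1 3 (by decide) (by decide)
  have h₅ := hv 1 2 4 (by decide) (by decide)
  have h₆ := hv 0 1 6 (by decide) (by decide)
  have h₇ := hv 0 2 4 (by decide) (by decide)
  have h₈ := hv 1 2 3 (by decide) (by decide)
  have h₉ := hv 0 3 6 (by decide) (by decide)
  have h₁₀ := hv 0 1 2 (by decide) (by decide)
  have plucker₁ : orient (v 1) (v 2) (v 4) * orient (v 0) (v 2) (v 3) =
      orient (v 2) (v 3) (v 4) * orient (v 0) (v 1) (v 2) +
        orient (v 0) (v 2) (v 4) * orient (v 1) (v 2) (v 3) := by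
    simp only [orient_eq]; ring
  have plucker₂ : orient (v 0) (v 2) (v 6) * orient (v 0) (v 1) (v 3) =
      orient (v 0) (v 1) (v 6) * orient (v 0) (v 2) (v 3) +
        orient (v 0) (v 3) (v 6) * orient (v 0) (v 1) (v 2) := by
    simp only [orient_eq]; ring
  obtain ⟨K, hK⟩ : ∃ K, K = orient (v 3) (v 4) (v 5) * orient (v 4) (v 5) (v 6) *
    orient (v 0) (v 5) (v 6) := ⟨_, rfl⟩
  have K_nonneg : 0 ≤ K := by rw [hK]; positivity
  have h := mul_lt_mul'' (mul_lt_mul'' ha' hb' (by positivity) (by positivity)) hc'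
    (by positivity) (by positivity)
  have h' : 0 ≤ K * (orient (v 0) (v 1) (v 6) *
      (orient (v 0) (v 2) (v 4) * orient (v 1) (v 2) (v 3)) + orient (v 1) (v 2) (v 4) *
      (orient (v 0) (v 3) (v 6) * orient (v 0) (v 1) (v 2))) := by positivity
  subst hK
  refine lt_irrefl (0 : ℝ) ?_
  linear_combination h + h' - orient (v 3) (v 4) (v 5) * orient (v 4) (v 5) (v 6) *
    orient (v 0) (v 5) (v 6) * (orient (v 0) (v 1) (v 6) * plucker₁ +
      orient (v 1) (v 2) (v 4) * plucker₂)

lemma IsConvexHeptagon.exists_rotation {v : Fin 7 → Fin 3 → ℝ} (hv : IsConvexHeptagon v) :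
    ∃ c, LeftCond (fun i => v (i + c)) ∧ RightCond (fun i => v (i + c)) := by
  by_contra! H
  by_cases hr : ∀ c, RightCond fun i => v (i + c)
  · have hl : ∀ c, ¬ LeftCond fun i => v (i + c) := fun c h => H c h (hr c)
    obtain h | h | h := hv.exists_leftCond
    · exact hl 0 (by simpa using h)
    · exact hl 1 h
    · exact hl 2 h
  · obtain ⟨c, hc⟩ := not_forall.1 hr
    have step : ∀ d, ¬ RightCond (fun i => v (i + d)) → ¬ RightCond (fun i => v (i + (d + 3))) := by
      intro d hd
      apply H
      convert (hv.rotate d).leftCond_rotate_three hd using 3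
      abel
    have reach : ∀ n : ℕ, ¬ RightCond fun i => v (i + (c + n • 3)) := by
      intro n
      induction n with
      | zero => simpa using hc
      | succ n ih =>
        rw [succ_nsmul, ← add_assoc]
        exact step _ ih
    have reach₁ := reach 5
    have reach₂ := reach 3
    rw [show 5 • (3 : Fin 7) = 1 by decide] at reach₁
    rw [show 3 • (3 : Fin 7) = 2 by decide] at reach₂
    simp only [add_comm c, ← add_assoc] at reach₁ reach₂
    obtain h | h | h := (hv.rotate c).exists_rightCond
    · exact hc h
    · exact reach₁ h
    · exact reach₂ h

/-- A heptagon satisfying `LeftCond` and `RightCond` is a section of a polytope with six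
vertices. -/
lemma IsConvexHeptagon.exists_lift {v : Fin 7 → Fin 3 → ℝ} (hv : IsConvexHeptagon v)
    (hl : LeftCond v) (hr : RightCond v) :
    ∃ R : Matrix (Fin 7) (Fin 6) ℝ, (∀ i k, 0 ≤ R i k) ∧
      ∀ x, (∀ i, 0 ≤ v i ⬝ᵥ x) → ∃ s : Fin 6 → ℝ, (∀ k, 0 ≤ s k) ∧ ∀ i, v i ⬝ᵥ x = (R *ᵥ s) i := by
  have pos : ∀ i j k, i < j → j < k → 0 < orient (v i) (v j) (v k) := hv
  obtain ⟨l₀, e₀⟩ : ∃ l, l = orient (v 1) (v 5) (v 6) * orient (v 2) (v 3) (v 4) := ⟨_, rfl⟩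
  obtain ⟨l₁, e₁⟩ : ∃ l, l = orient (v 0) (v 5) (v 6) * orient (v 2) (v 3) (v 4) := ⟨_, rfl⟩
  obtain ⟨l₂, e₂⟩ : ∃ l, l = orient (v 3) (v 4) (v 5) * orient (v 0) (v 1) (v 6) := ⟨_, rfl⟩
  obtain ⟨l₃, e₃⟩ : ∃ l, l = orient (v 2) (v 4) (v 5) * orient (v 0) (v 1) (v 6) := ⟨_, rfl⟩
  obtain ⟨l₄, e₄⟩ : ∃ l, l = orient (v 2) (v 3) (v 5) * orient (v 0) (v 1) (v 6) := ⟨_, rfl⟩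
  obtain ⟨l₅, e₅⟩ : ∃ l, l = orient (v 0) (v 1) (v 6) * orient (v 2) (v 3) (v 4) := ⟨_, rfl⟩
  obtain ⟨l₆, e₆⟩ : ∃ l, l = orient (v 0) (v 1) (v 5) * orient (v 2) (v 3) (v 4) := ⟨_, rfl⟩
  have p₀ : 0 < l₀ := e₀ ▸
    mul_pos (pos _ _ _ (by decide) (by decide)) (pos _ _ _ (by decide) (by decide))
  have p₁ : 0 < l₁ := e₁ ▸
    mul_pos (pos _ _ _ (by decide) (by decide)) (pos _ _ _ (by decide) (by decide))
  have p₂ : 0 < l₂ := e₂ ▸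
    mul_pos (pos _ _ _ (by decide) (by decide)) (pos _ _ _ (by decide) (by decide))
  have p₃ : 0 < l₃ := e₃ ▸
    mul_pos (pos _ _ _ (by decide) (by decide)) (pos _ _ _ (by decide) (by decide))
  have p₄ : 0 < l₄ := e₄ ▸
    mul_pos (pos _ _ _ (by decide) (by decide)) (pos _ _ _ (by decide) (by decide))
  have p₅ : 0 < l₅ := e₅ ▸
    mul_pos (pos _ _ _ (by decide) (by decide)) (pos _ _ _ (by decide) (by decide))
  have p₆ : 0 < l₆ := e₆ ▸
    mul_pos (pos _ _ _ (by decide) (by decide)) (pos _ _ _ (by decide) (by decide))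
  refine ⟨!![l₀⁻¹, 0, 0, l₀⁻¹, 0, 0; 0, l₁⁻¹, 0, l₁⁻¹, 0, 0; 0, l₂⁻¹, 0, 0, l₂⁻¹, 0;
    0, 0, l₃⁻¹, 0, l₃⁻¹, 0; 0, 0, l₄⁻¹, 0, 0, l₄⁻¹; 0, l₅⁻¹, 0, 0, 0, l₅⁻¹;
    l₆⁻¹, 0, 0, 0, 0, l₆⁻¹], ?_, ?_⟩
  · intro i k
    fin_cases i <;> fin_cases k <;> simp <;> positivity
  intro x hx
  obtain ⟨y, hy⟩ : ∃ y : Fin 7 → ℝ, ∀ i, v i ⬝ᵥ x = y i := ⟨_, fun _ => rfl⟩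
  simp only [hy] at hx ⊢
  have rel₁ : l₀ * y 0 + l₅ * y 5 = l₁ * y 1 + l₆ * y 6 := by
    have := orient_dotProduct_relation (v 0) (v 1) (v 5) (v 6) x
    simp only [hy] at this
    subst e₀ e₁ e₅ e₆
    linear_combination orient (v 2) (v 3) (v 4) * this
  have rel₂ : l₂ * y 2 + l₄ * y 4 = l₃ * y 3 + l₅ * y 5 := by
    have := orient_dotProduct_relation (v 2) (v 3) (v 4) (v 5) x
    simp only [hy] at this
    subst e₂ e₃ e₄ e₅
    linear_combination orient (v 0) (v 1) (v 6) * this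
  have left : l₁ * y 1 ≤ l₀ * y 0 + l₂ * y 2 := by
    have rel := orient_dotProduct_relation (v 0) (v 1) (v 2) (v 6) x
    simp only [hy] at rel
    have plucker : orient (v 0) (v 2) (v 6) * orient (v 1) (v 5) (v 6) =
        orient (v 0) (v 1) (v 6) * orient (v 2) (v 5) (v 6) +
          orient (v 0) (v 5) (v 6) * orient (v 1) (v 2) (v 6) := by
      simp only [orient_eq]; ring
    have h₀ : 0 ≤ orient (v 2) (v 3) (v 4) * (orient (v 0) (v 1) (v 6) *
        orient (v 2) (v 5) (v 6)) * y 0 :=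
      mul_nonneg (mul_pos (pos _ _ _ (by decide) (by decide)) (mul_pos
        (pos _ _ _ (by decide) (by decide)) (pos _ _ _ (by decide) (by decide)))).le (hx 0)
    have h₂ : 0 ≤ (orient (v 3) (v 4) (v 5) * orient (v 0) (v 2) (v 6) -
        orient (v 2) (v 3) (v 4) * orient (v 0) (v 5) (v 6)) * orient (v 0) (v 1) (v 6) * y 2 :=
      mul_nonneg (mul_nonneg (sub_nonneg.2 hl) (pos _ _ _ (by decide) (by decide)).le) (hx 2)
    have h₆ : 0 ≤ l₁ * orient (v 0) (v 1) (v 2) * y 6 :=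
      mul_nonneg (mul_pos p₁ (pos _ _ _ (by decide) (by decide))).le (hx 6)
    refine le_of_mul_le_mul_left ?_ (pos 0 2 6 (by decide) (by decide))
    subst e₀ e₁ e₂
    linear_combination h₀ + h₂ + h₆ - orient (v 2) (v 3) (v 4) * y 0 * plucker -
      orient (v 0) (v 5) (v 6) * orient (v 2) (v 3) (v 4) * rel
  have right : l₂ * y 2 ≤ l₁ * y 1 + l₃ * y 3 := by
    have rel := orient_dotProduct_relation (v 1) (v 2) (v 3) (v 4) x
    simp only [hy] at rel
    have plucker : orient (v 1) (v 3) (v 4) * orient (v 2) (v 4) (v 5) =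
        orient (v 1) (v 2) (v 4) * orient (v 3) (v 4) (v 5) +
          orient (v 1) (v 4) (v 5) * orient (v 2) (v 3) (v 4) := by
      simp only [orient_eq]; ring
    have h₁ : 0 ≤ (orient (v 0) (v 5) (v 6) * orient (v 1) (v 3) (v 4) -
        orient (v 0) (v 1) (v 6) * orient (v 3) (v 4) (v 5)) * orient (v 2) (v 3) (v 4) * y 1 :=
      mul_nonneg (mul_nonneg (sub_nonneg.2 hr) (pos _ _ _ (by decide) (by decide)).le) (hx 1)
    have h₃ : 0 ≤ orient (v 0) (v 1) (v 6) * (orient (v 1) (v 4) (v 5) *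
        orient (v 2) (v 3) (v 4)) * y 3 :=
      mul_nonneg (mul_pos (pos _ _ _ (by decide) (by decide)) (mul_pos
        (pos _ _ _ (by decide) (by decide)) (pos _ _ _ (by decide) (by decide)))).le (hx 3)
    have h₄ : 0 ≤ l₂ * orient (v 1) (v 2) (v 3) * y 4 :=
      mul_nonneg (mul_pos p₂ (pos _ _ _ (by decide) (by decide))).le (hx 4)
    refine le_of_mul_le_mul_left ?_ (pos 1 3 4 (by decide) (by decide))
    subst e₁ e₂ e₃
    linear_combination h₁ + h₃ + h₄ - orient (v 0) (v 1) (v 6) * y 3 * plucker -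
      orient (v 3) (v 4) (v 5) * orient (v 0) (v 1) (v 6) * rel
  obtain ⟨t, ht₁, ht₂, ht₅, ht⟩ : ∃ t, t ≤ l₁ * y 1 ∧ t ≤ l₂ * y 2 ∧ t ≤ l₅ * y 5 ∧
      (t = l₁ * y 1 ∨ t = l₂ * y 2 ∨ t = l₅ * y 5) := by
    refine ⟨min (l₁ * y 1) (min (l₂ * y 2) (l₅ * y 5)), by simp, by simp, by simp, ?_⟩
    grind
  have q := fun i (l : ℝ) (hl : 0 < l) => mul_nonneg hl.le (hx i)
  have q₀ := q 0 l₀ p₀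
  have q₁ := q 1 l₁ p₁
  have q₂ := q 2 l₂ p₂
  have q₃ := q 3 l₃ p₃
  have q₄ := q 4 l₄ p₄
  have q₅ := q 5 l₅ p₅
  have q₆ := q 6 l₆ p₆
  refine ⟨![l₀ * y 0 - l₁ * y 1 + t, t, l₃ * y 3 - l₂ * y 2 + t,
    l₁ * y 1 - t, l₂ * y 2 - t, l₅ * y 5 - t], ?_, ?_⟩
  · intro k
    fin_cases k <;> simp <;> rcases ht with rfl | rfl | rfl <;> linarith
  · intro i
    fin_cases i <;> simp [Matrix.mulVec, dotProduct, Fin.sum_univ_succ] <;> field_simp <;> linarith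

/-- No vector of the family is a nonnegative combination of three others. -/
def ConicallyIndependent {n : ℕ} (v : Fin n → Fin 3 → ℝ) : Prop :=
  ∀ i a b c, i ≠ a → i ≠ b → i ≠ c → ∀ α β γ : ℝ, 0 ≤ α → 0 ≤ β → 0 ≤ γ →
    v i ≠ α • v a + β • v b + γ • v c

lemma exists_equiv_of_isStrictTotalOrder {α : Type*} [Fintype α] (r : α → α → Prop)
    [IsStrictTotalOrder α r] {k : ℕ} (h : Fintype.card α = k) :
    ∃ e : Fin k ≃ α, ∀ i j, i < j → r (e i) (e j) := by
  classical
  let := linearOrderOfSTO r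
  exact ⟨(monoEquivOfFin α h).toEquiv, fun i j hij => (monoEquivOfFin α h).lt_iff_lt.2 hij⟩

/-- If every coefficient of a positively weighted vanishing sum shares its strict sign with another
one,
then all of them vanish. -/
lemma eq_zero_of_weighted_sum_eq_zero {a b c x y z : ℝ} (hx : 0 < x) (hy : 0 < y) (hz : 0 < z)
    (h : a * x + b * y + c * z = 0) (ha : 0 < a → 0 < b ∨ 0 < c) (hb : 0 < b → 0 < a ∨ 0 < c)
    (hc : 0 < c → 0 < a ∨ 0 < b) (ha' : a < 0 → b < 0 ∨ c < 0) (hb' : b < 0 → a < 0 ∨ c < 0)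
    (hc' : c < 0 → a < 0 ∨ b < 0) : a = 0 ∧ b = 0 ∧ c = 0 := by
  have key : (0 ≤ a ∧ 0 ≤ b ∧ 0 ≤ c) ∨ (a ≤ 0 ∧ b ≤ 0 ∧ c ≤ 0) := by grind
  obtain ⟨h₁, h₂, h₃⟩ | ⟨h₁, h₂, h₃⟩ := key
  · have := mul_nonneg h₁ hx.le
    have := mul_nonneg h₂ hy.le
    have := mul_nonneg h₃ hz.le
    refine ⟨?_, ?_, ?_⟩
    · exact (mul_eq_zero_iff_right hx.ne').1 (by linarith)
    · exact (mul_eq_zero_iff_right hy.ne').1 (by linarith)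
    · exact (mul_eq_zero_iff_right hz.ne').1 (by linarith)
  · have := mul_nonpos_of_nonpos_of_nonneg h₁ hx.le
    have := mul_nonpos_of_nonpos_of_nonneg h₂ hy.le
    have := mul_nonpos_of_nonpos_of_nonneg h₃ hz.le
    refine ⟨?_, ?_, ?_⟩
    · exact (mul_eq_zero_iff_right hx.ne').1 (by linarith)
    · exact (mul_eq_zero_iff_right hy.ne').1 (by linarith)
    · exact (mul_eq_zero_iff_right hz.ne').1 (by linarith)

lemma ConicallyIndependent.orient_ne_zero {n : ℕ} {v : Fin n → Fin 3 → ℝ}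
    (hv : ConicallyIndependent v) {w : Fin 3 → ℝ} (hw : ∀ i, 0 < v i ⬝ᵥ w) {i j k : Fin n}
    (hij : i ≠ j) (hik : i ≠ k) (hjk : j ≠ k) : orient (v i) (v j) (v k) ≠ 0 := by
  intro h
  obtain ⟨c, hc, h⟩ := Matrix.exists_vecMul_eq_zero_iff.2 h
  have rel : c 0 • v i + c 1 • v j + c 2 • v k = 0 := by
    rw [← h]
    ext p
    simp [Matrix.vecMul, dotProduct, Fin.sum_univ_three]
  have relw : c 0 * (v i ⬝ᵥ w) + c 1 * (v j ⬝ᵥ w) + c 2 * (v k ⬝ᵥ w) = 0 := by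
    simpa only [add_dotProduct, smul_dotProduct, smul_eq_mul, zero_dotProduct] using
      congrArg (· ⬝ᵥ w) rel
  have main : ∀ (p q r : Fin n) (α β γ : ℝ), p ≠ q → p ≠ r → α • v p + β • v q + γ • v r = 0 →
      0 < α → 0 < β ∨ 0 < γ := by
    intro p q r α β γ hpq hpr hrel hα
    by_contra! ⟨hβ, hγ⟩
    refine hv p q q r hpq hpq hpr 0 (-β / α) (-γ / α) le_rfl
      (div_nonneg (neg_nonneg.2 hβ) hα.le) (div_nonneg (neg_nonneg.2 hγ) hα.le) ?_
    ext s
    have := congrFun hrel s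
    simp at this ⊢
    field_simp
    linarith
  have main' : ∀ (p q r : Fin n) (α β γ : ℝ), p ≠ q → p ≠ r →
      α • v p + β • v q + γ • v r = 0 → α < 0 → β < 0 ∨ γ < 0 := by
    intro p q r α β γ hpq hpr hrel hα
    have := main p q r (-α) (-β) (-γ) hpq hpr
      (by rw [neg_smul, neg_smul, neg_smul, ← neg_add, ← neg_add, hrel, neg_zero])
    simpa using this (neg_pos.2 hα)
  have rel₁ : c 1 • v j + c 0 • v i + c 2 • v k = 0 := by rw [← rel]; abel
  have rel₂ : c 2 • v k + c 0 • v i + c 1 • v j = 0 := by rw [← rel]; abel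
  have m₀ := main i j k _ _ _ hij hik rel
  have m₁ := main j i k _ _ _ hij.symm hjk rel₁
  have m₂ := main k i j _ _ _ hik.symm hjk.symm rel₂
  have m₀' := main' i j k _ _ _ hij hik rel
  have m₁' := main' j i k _ _ _ hij.symm hjk rel₁
  have m₂' := main' k i j _ _ _ hik.symm hjk.symm rel₂
  have hc' : ¬ (c 0 = 0 ∧ c 1 = 0 ∧ c 2 = 0) := fun h => hc (by
    ext s
    fin_cases s <;> simp [h])
  exact hc' (eq_zero_of_weighted_sum_eq_zero (hw i) (hw j) (hw k) relw m₀ m₁ m₂ m₀' m₁' m₂')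

/-- Conically independent vectors in an open half-space can be put in convex position. -/
lemma ConicallyIndependent.exists_perm {v : Fin 7 → Fin 3 → ℝ}
    (hv : ConicallyIndependent v) {w : Fin 3 → ℝ} (hw : ∀ i, 0 < v i ⬝ᵥ w) :
    ∃ e : Fin 7 ≃ Fin 7, IsConvexHeptagon (v ∘ e) := by
  let r : Fin 6 → Fin 6 → Prop := fun i j => 0 < orient (v 0) (v i.succ) (v j.succ)
  have hr : IsStrictTotalOrder (Fin 6) r := {
    trichotomous := fun i j hij hji => by
      by_contra h
      have := hv.orient_ne_zero hw (Fin.succ_ne_zero i).symm (Fin.succ_ne_zero j).symm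
        (fun h' => h (Fin.succ_injective _ h'))
      simp only [r, orient_swap (v 0) (v i.succ) (v j.succ)] at hij hji
      grind
    irrefl := fun i hi => by
      have := orient_swap (v 0) (v i.succ) (v i.succ)
      simp only [r] at hi
      linarith
    trans := fun i j k hij hjk => by
      simp only [r] at *
      have hik : i ≠ k := by
        rintro rfl
        rw [orient_swap] at hjk
        linarith
      by_contra hle
      have hlt := lt_of_le_of_ne (not_lt.1 hle) (hv.orient_ne_zero hw (Fin.succ_ne_zero i).symm
        (Fin.succ_ne_zero k).symm (fun h' => hik (Fin.succ_injective _ h')))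
      have relw := orient_dotProduct_relation (v 0) (v i.succ) (v j.succ) (v k.succ) w
      have hpos : 0 < orient (v i.succ) (v j.succ) (v k.succ) := by
        refine pos_of_mul_pos_left (b := v 0 ⬝ᵥ w) ?_ (hw 0).le
        have h₁ := mul_pos hjk (hw i.succ)
        have h₂ := mul_pos hij (hw k.succ)
        have h₃ := mul_neg_of_neg_of_pos hlt (hw j.succ)
        linarith
      refine hv 0 i.succ j.succ k.succ (Fin.succ_ne_zero i).symm (Fin.succ_ne_zero j).symm
        (Fin.succ_ne_zero k).symm _ _ _ (div_pos hjk hpos).le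
        (div_pos (neg_pos.2 hlt) hpos).le (div_pos hij hpos).le ?_
      ext s
      have := congrFun (orient_smul_relation (v 0) (v i.succ) (v j.succ) (v k.succ)) s
      simp at this ⊢
      field_simp
      linarith }
  obtain ⟨e, he⟩ := exists_equiv_of_isStrictTotalOrder r (Fintype.card_fin 6)
  refine ⟨Equiv.Perm.decomposeFin.symm (0, e), fun i j k hij hjk => ?_⟩
  obtain ⟨j, rfl⟩ := Fin.exists_succ_eq.2 (Fin.ne_zero_of_lt hij)
  obtain ⟨k, rfl⟩ := Fin.exists_succ_eq.2 (Fin.ne_zero_of_lt hjk)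
  have hjk' := he j k (Fin.succ_lt_succ_iff.1 hjk)
  induction i using Fin.cases with
  | zero => simpa using hjk'
  | succ i =>
    have hij' := he i j (Fin.succ_lt_succ_iff.1 hij)
    have hik' := he i k (Fin.succ_lt_succ_iff.1 (hij.trans hjk))
    have ne : ∀ p q : Fin 6, p < q → (e p).succ ≠ (e q).succ := fun p q hpq h =>
      hpq.ne (e.injective (Fin.succ_injective _ h))
    simp only [r, Function.comp_apply, Equiv.Perm.decomposeFin_symm_apply_succ, Equiv.swap_self,
      Equiv.refl_apply] at *
    by_contra hle
    refine hv (e j).succ (e i).succ (e k).succ 0 (ne _ _ (Fin.succ_lt_succ_iff.1 hij)).symm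
      (ne _ _ (Fin.succ_lt_succ_iff.1 hjk)) (Fin.succ_ne_zero _) _ _ _ (div_pos hjk' hik').le
      (div_pos hij' hik').le (div_nonneg (neg_nonneg.2 (not_lt.1 hle)) hik'.le) ?_
    ext s
    have := congrFun (orient_smul_relation (v 0) (v (e i).succ) (v (e j).succ) (v (e k).succ)) s
    simp at this ⊢
    field_simp
    linarith

/-- `M` has a nonnegative factorization with inner dimension `r`. -/
def HasNonnegFactorization {ι κ : Type*} (M : Matrix ι κ ℝ) (r : ℕ) : Prop :=
  ∃ (R : Matrix ι (Fin r) ℝ) (S : Matrix (Fin r) κ ℝ),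
    (∀ i j, 0 ≤ R i j) ∧ (∀ i j, 0 ≤ S i j) ∧ M = R * S

lemma hasNonnegFactorization_fromRows {ι₁ ι₂ κ : Type*} {M₁ : Matrix ι₁ κ ℝ} {M₂ : Matrix ι₂ κ ℝ}
    {r₁ r₂ : ℕ} (h₁ : HasNonnegFactorization M₁ r₁) (h₂ : HasNonnegFactorization M₂ r₂) :
    HasNonnegFactorization (Matrix.fromRows M₁ M₂) (r₁ + r₂) := by
  obtain ⟨R₁, S₁, hR₁, hS₁, rfl⟩ := h₁
  obtain ⟨R₂, S₂, hR₂, hS₂, rfl⟩ := h₂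
  refine ⟨(Matrix.fromBlocks R₁ 0 0 R₂).submatrix id finSumFinEquiv.symm,
    (Matrix.fromRows S₁ S₂).submatrix finSumFinEquiv.symm id, ?_, ?_, ?_⟩
  · intro i j
    rw [Matrix.submatrix_apply]
    rcases i with i | i <;> rcases finSumFinEquiv.symm j with j | j <;> simp [hR₁, hR₂]
  · intro i j
    rw [Matrix.submatrix_apply]
    rcases finSumFinEquiv.symm i with i | i <;> simp [hS₁, hS₂]
  · rw [Matrix.submatrix_mul_equiv, Matrix.fromBlocks_mul_fromRows]
    simp

lemma HasNonnegFactorization.submatrix {ι ι' κ κ' : Type*} {M : Matrix ι κ ℝ} {r : ℕ}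
    (h : HasNonnegFactorization M r) (f : ι' → ι) (g : κ' → κ) :
    HasNonnegFactorization (M.submatrix f g) r := by
  obtain ⟨R, S, hR, hS, rfl⟩ := h
  exact ⟨R.submatrix f id, S.submatrix id g, fun _ _ => hR _ _, fun _ _ => hS _ _,
    (Matrix.submatrix_mul R S f id g Function.bijective_id)⟩

lemma HasNonnegFactorization.transpose {ι κ : Type*} {M : Matrix ι κ ℝ} {r : ℕ}
    (h : HasNonnegFactorization M r) : HasNonnegFactorization Mᵀ r := by
  obtain ⟨R, S, hR, hS, rfl⟩ := h
  exact ⟨Sᵀ, Rᵀ, fun _ _ => hS _ _, fun _ _ => hR _ _, Matrix.transpose_mul R S⟩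

/-- A row that is a nonnegative combination of other rows does not contribute to the
nonnegative rank. -/
lemma hasNonnegFactorization_of_row_eq {n : ℕ} {κ : Type*} {M : Matrix (Fin (n + 1)) κ ℝ}
    (hM : ∀ i j, 0 ≤ M i j) {i a b c : Fin (n + 1)} (ha : i ≠ a) (hb : i ≠ b) (hc : i ≠ c)
    {α β γ : ℝ} (hα : 0 ≤ α) (hβ : 0 ≤ β) (hγ : 0 ≤ γ)
    (h : M i = α • M a + β • M b + γ • M c) : HasNonnegFactorization M n := by
  obtain ⟨a, rfl⟩ := Fin.exists_succAbove_eq ha.symm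
  obtain ⟨b, rfl⟩ := Fin.exists_succAbove_eq hb.symm
  obtain ⟨c, rfl⟩ := Fin.exists_succAbove_eq hc.symm
  let N : Matrix (Fin n) κ ℝ := M.submatrix i.succAbove id
  let u : Fin n → ℝ := Pi.single a α + Pi.single b β + Pi.single c γ
  have hu : 0 ≤ u := add_nonneg (add_nonneg (Pi.single_nonneg.2 hα) (Pi.single_nonneg.2 hβ))
    (Pi.single_nonneg.2 hγ)
  refine ⟨Matrix.of (i.insertNth (α := fun _ => Fin n → ℝ) u fun p => Pi.single p 1), N,
    ?_, fun _ _ => hM _ _, ?_⟩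
  · intro p q
    induction p using i.succAboveCases with
    | x => simpa using hu q
    | p p =>
      rw [Matrix.of_apply, Fin.insertNth_apply_succAbove, Pi.single_apply]
      split_ifs <;> norm_num
  · ext p q
    induction p using i.succAboveCases with
    | x =>
      simp [Matrix.mul_apply, h, u, add_mul, Finset.sum_add_distrib, N, Pi.single_apply]
    | p p => simp [Matrix.mul_apply, N, Pi.single_apply]

/-- A nonnegative matrix with seven rows and rank at most three has nonnegative rank at most
six. -/
lemma hasNonnegFactorization_six {m : ℕ} (A : Matrix (Fin 7) (Fin 3) ℝ)
    (B : Matrix (Fin 3) (Fin m) ℝ) (hAB : ∀ i j, 0 ≤ (A * B) i j) :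
    HasNonnegFactorization (A * B) 6 := by
  by_cases hv : ConicallyIndependent A
  · by_cases hw : ∀ i, 0 < A i ⬝ᵥ (B *ᵥ 1)
    · obtain ⟨e, he⟩ := hv.exists_perm hw
      obtain ⟨d, hl, hr⟩ := he.exists_rotation
      obtain ⟨R, hR, hlift⟩ := (he.rotate d).exists_lift hl hr
      have : ∀ j, ∃ s : Fin 6 → ℝ, (∀ k, 0 ≤ s k) ∧
          ∀ i, A (e (i + d)) ⬝ᵥ (fun k => B k j) = (R *ᵥ s) i :=
        fun j => hlift _ fun i => hAB _ _
      choose s hs hRs using this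
      have key : HasNonnegFactorization ((A * B).submatrix (fun i => e (i + d)) id) 6 :=
        ⟨R, Matrix.of fun k j => s j k, hR, fun _ _ => hs _ _, Matrix.ext fun i j => hRs j i⟩
      convert key.submatrix (fun i => e.symm i - d) id using 1
      ext i j
      simp
    · push Not at hw
      obtain ⟨i, hi⟩ := hw
      have hrow : ∀ j, (A * B) i j = 0 := by
        have hsum : A i ⬝ᵥ (B *ᵥ 1) = ∑ j, (A * B) i j := by
          rw [Matrix.dotProduct_mulVec, dotProduct_one]
          rfl
        intro j
        exact (Finset.sum_eq_zero_iff_of_nonneg fun j _ => hAB i j).1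
          ((hsum ▸ hi).antisymm (Finset.sum_nonneg fun j _ => hAB i j)) j (Finset.mem_univ j)
      obtain ⟨a, ha⟩ := exists_ne i
      exact hasNonnegFactorization_of_row_eq hAB ha.symm ha.symm ha.symm le_rfl le_rfl le_rfl
        (by ext j; simp [hrow])
  · unfold ConicallyIndependent at hv
    push Not at hv
    obtain ⟨i, a, b, c, ha, hb, hc, α, β, γ, hα, hβ, hγ, h⟩ := hv
    refine hasNonnegFactorization_of_row_eq hAB ha hb hc hα hβ hγ ?_
    ext j
    have h' := congrArg (· ⬝ᵥ fun k => B k j) h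
    simp only [add_dotProduct, smul_dotProduct] at h'
    exact h'

lemma hasNonnegFactorization_mul {n m : ℕ} (A : Matrix (Fin n) (Fin 3) ℝ)
    (B : Matrix (Fin 3) (Fin m) ℝ) (hAB : ∀ i j, 0 ≤ (A * B) i j) :
    HasNonnegFactorization (A * B) ((6 * n + 6) / 7) := by
  induction n using Nat.strong_induction_on with
  | _ n ih =>
    obtain hn | hn := lt_or_ge n 7
    · rw [show (6 * n + 6) / 7 = n by omega]
      refine ⟨1, A * B, fun i j => ?_, hAB, (Matrix.one_mul _).symm⟩
      rw [Matrix.one_apply]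
      split_ifs <;> norm_num
    · obtain ⟨k, rfl⟩ := Nat.exists_eq_add_of_le' hn
      have h₁ := ih k (by omega) (A.submatrix (Fin.castAdd 7) id) fun i j => hAB (Fin.castAdd 7 i) j
      have h₂ := hasNonnegFactorization_six (A.submatrix (Fin.natAdd k) id) B
        fun i j => hAB (Fin.natAdd k i) j
      have h := (hasNonnegFactorization_fromRows h₁ h₂).submatrix finSumFinEquiv.symm id
      rw [show (6 * (k + 7) + 6) / 7 = (6 * k + 6) / 7 + 6 by omega]
      convert h using 1
      ext i j
      induction i using Fin.addCases with
      | left i => simp [Matrix.mul_apply]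
      | right i => simp [Matrix.mul_apply]

/-- Rank factorization. -/
lemma Matrix.exists_eq_mul_of_rank_eq {n m r : ℕ} {M : Matrix (Fin n) (Fin m) ℝ}
    (h : M.rank = r) :
    ∃ (A : Matrix (Fin n) (Fin r) ℝ) (B : Matrix (Fin r) (Fin m) ℝ), M = A * B := by
  let b := Module.finBasisOfFinrankEq ℝ (LinearMap.range M.mulVecLin) h
  have hmem : ∀ j, M *ᵥ Pi.single j 1 ∈ LinearMap.range M.mulVecLin := fun j => ⟨_, rfl⟩
  refine ⟨Matrix.of fun i k => (b k : Fin n → ℝ) i,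
    Matrix.of fun k j => b.repr ⟨_, hmem j⟩ k, ?_⟩
  ext i j
  calc M i j = (M *ᵥ Pi.single j 1) i := by simp
    _ = ((∑ k, b.repr ⟨_, hmem j⟩ k • b k : LinearMap.range M.mulVecLin) : Fin n → ℝ) i := by
      rw [b.sum_repr]
    _ = _ := by
      simp only [Matrix.mul_apply, Matrix.of_apply, Submodule.coe_sum, Submodule.coe_smul,
        Finset.sum_apply, Pi.smul_apply, smul_eq_mul, mul_comm]

/-- Every nonnegative real `n × m` matrix of rank 3 has nonnegative rank at most
`⌈6·min(n,m)/7⌉` (which equals `(6 * min n m + 6) / 7` in ℕ). -/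
theorem nonnegative_rank_of_rank_three
    (n m : ℕ) (M : Matrix (Fin n) (Fin m) ℝ)
    (hM : ∀ i j, 0 ≤ M i j) (hrank : M.rank = 3) :
    ∃ (r : ℕ) (R : Matrix (Fin n) (Fin r) ℝ) (S : Matrix (Fin r) (Fin m) ℝ),
      r ≤ (6 * min n m + 6) / 7 ∧
      (∀ i j, 0 ≤ R i j) ∧ (∀ i j, 0 ≤ S i j) ∧ M = R * S := by
  obtain ⟨A, B, rfl⟩ := Matrix.exists_eq_mul_of_rank_eq hrank
  obtain ⟨R, S, h⟩ : HasNonnegFactorization (A * B) ((6 * min n m + 6) / 7) := by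
    obtain h | h := le_total n m
    · rw [min_eq_left h]
      exact hasNonnegFactorization_mul A B hM
    · rw [min_eq_right h]
      have := hasNonnegFactorization_mul Bᵀ Aᵀ fun i j => by
        rw [← Matrix.transpose_mul]; exact hM j i
      rw [← Matrix.transpose_mul] at this
      exact this.transpose
  exact ⟨_, R, S, le_rfl, h⟩
end
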